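/- arXiv:2005.10564 — 2 statements merged into one kernel-verified Lean document; each statement's English description precedes it below -/
import Mathlib

section
/- Let k ∈ ℝ and let r, u, R, U, H_r, H_u be C² real-valued functions of (T,X) such that r satisfies ∂_T r = −∂_X u − 2(u+k)∂_X r pointwise, and (R,U) satisfies the linearized system ∂_T R = −∂_X U − 2U∂_X r − 2(u+k)∂_X R + H_r, ∂_T U = −2∂_X((u+k)U) − 2∂_X(e^{2r}R) + H_u pointwise. Define the energy density Ê(T,X) = e^{2r}U² + 2e^{4r}R² and the flux F̂(T,X) = 2(u+k)e^{2r}U² + 4(u+k)e^{4r}R² + 4e^{4r}UR. Then the pointwise identity ∂_T Ê + ∂_X F̂ = −4(∂_X u) e^{2r} U² − 4(∂_X u) e^{4r} R² + 2 e^{2r} U H_u + 4 e^{4r} R H_r holds at every (T,X). -/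
open Function

noncomputable section

/-- Partial derivative in the first (slow time) variable. -/
def pT (f : ℝ → ℝ → ℝ) (t x : ℝ) : ℝ := deriv (fun τ => f τ x) t
/-- Partial derivative in the second (slow space) variable. -/
def pX (f : ℝ → ℝ → ℝ) (t x : ℝ) : ℝ := deriv (fun y => f t y) x

theorem hasDerivAt_pT {f : ℝ → ℝ → ℝ} {n : WithTop ℕ∞} (hf : ContDiff ℝ n (uncurry f))
    (hn : n ≠ 0) (t x : ℝ) : HasDerivAt (fun τ => f τ x) (pT f t x) t := by
  have h : DifferentiableAt ℝ (fun τ : ℝ => uncurry f (τ, x)) t :=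
    ((hf.differentiable hn).comp
      (differentiable_id.prodMk (differentiable_const x))) t
  exact h.hasDerivAt

theorem hasDerivAt_pX {f : ℝ → ℝ → ℝ} {n : WithTop ℕ∞} (hf : ContDiff ℝ n (uncurry f))
    (hn : n ≠ 0) (t x : ℝ) : HasDerivAt (fun y => f t y) (pX f t x) x := by
  have h : DifferentiableAt ℝ (fun y : ℝ => uncurry f (t, y)) x :=
    ((hf.differentiable hn).comp
      ((differentiable_const t).prodMk differentiable_id)) x
  exact h.hasDerivAt

/-- the pointwise energy identity
`∂_T Ê + ∂_X F̂ = −4u_X e^{2r}U² − 4u_X e^{4r}R² + 2e^{2r}UH_u + 4e^{4r}RH_r`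
for the linearized energy density `Ê = e^{2r}U² + 2e^{4r}R²` and flux
`F̂ = 2(u+k)e^{2r}U² + 4(u+k)e^{4r}R² + 4e^{4r}UR` along solutions of the
inhomogeneous linearized Whitham system. -/
theorem linearized_energy_flux_identity (k : ℝ)
    (r u R U Hr Hu : ℝ → ℝ → ℝ)
    (hrC : ContDiff ℝ 2 (uncurry r)) (huC : ContDiff ℝ 2 (uncurry u))
    (hRC : ContDiff ℝ 2 (uncurry R)) (hUC : ContDiff ℝ 2 (uncurry U))
    (hHrC : ContDiff ℝ 2 (uncurry Hr)) (hHuC : ContDiff ℝ 2 (uncurry Hu))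
    (hreq : ∀ T X : ℝ, pT r T X = -pX u T X - 2 * (u T X + k) * pX r T X)
    (hReq : ∀ T X : ℝ,
      pT R T X = -pX U T X - 2 * U T X * pX r T X
        - 2 * (u T X + k) * pX R T X + Hr T X)
    (hUeq : ∀ T X : ℝ,
      pT U T X = -2 * pX (fun T X => (u T X + k) * U T X) T X
        - 2 * pX (fun T X => Real.exp (2 * r T X) * R T X) T X + Hu T X) :
    ∀ T X : ℝ,
      pT (fun T X => Real.exp (2 * r T X) * (U T X) ^ 2
          + 2 * Real.exp (4 * r T X) * (R T X) ^ 2) T X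
        + pX (fun T X => 2 * (u T X + k) * Real.exp (2 * r T X) * (U T X) ^ 2
          + 4 * (u T X + k) * Real.exp (4 * r T X) * (R T X) ^ 2
          + 4 * Real.exp (4 * r T X) * U T X * R T X) T X
      = -4 * pX u T X * Real.exp (2 * r T X) * (U T X) ^ 2
        - 4 * pX u T X * Real.exp (4 * r T X) * (R T X) ^ 2
        + 2 * Real.exp (2 * r T X) * U T X * Hu T X
        + 4 * Real.exp (4 * r T X) * R T X * Hr T X := by
  intro T X
  have rT := hasDerivAt_pT hrC two_ne_zero T X
  have RT := hasDerivAt_pT hRC two_ne_zero T X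
  have UT := hasDerivAt_pT hUC two_ne_zero T X
  have rX := hasDerivAt_pX hrC two_ne_zero T X
  have uX := (hasDerivAt_pX huC two_ne_zero T X).add_const k
  have RX := hasDerivAt_pX hRC two_ne_zero T X
  have UX := hasDerivAt_pX hUC two_ne_zero T X
  have e2X := (rX.const_mul 2).exp
  have e4X := (rX.const_mul 4).exp
  have hvU : pX (fun T X => (u T X + k) * U T X) T X = _ := (uX.mul UX).deriv
  have heR : pX (fun T X => Real.exp (2 * r T X) * R T X) T X = _ := (e2X.mul RX).deriv
  have hE : pT (fun T X => Real.exp (2 * r T X) * (U T X) ^ 2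
      + 2 * Real.exp (4 * r T X) * (R T X) ^ 2) T X = _ :=
    (((rT.const_mul 2).exp.mul (UT.pow 2)).add
      (((rT.const_mul 4).exp.const_mul 2).mul (RT.pow 2))).deriv
  have hF : pX (fun T X => 2 * (u T X + k) * Real.exp (2 * r T X) * (U T X) ^ 2
      + 4 * (u T X + k) * Real.exp (4 * r T X) * (R T X) ^ 2
      + 4 * Real.exp (4 * r T X) * U T X * R T X) T X = _ :=
    (((((uX.const_mul 2).mul e2X).mul (UX.pow 2)).add
      (((uX.const_mul 4).mul e4X).mul (RX.pow 2))).add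
      (((e4X.const_mul 4).mul UX).mul RX)).deriv
  have hexp : Real.exp (4 * r T X) = Real.exp (2 * r T X) ^ 2 := by
    rw [← Real.exp_nat_mul]
    congr 1
    push_cast
    ring
  rw [hE, hF, hUeq T X, hvU, heR, hReq T X, hreq T X]
  simp only [hexp, Pi.mul_apply, Pi.pow_apply]
  push_cast
  ring
end
end

section
/- Let γ ∈ ℝ, ω, k ∈ ℝ with γ = ω + k², ε > 0, and let Â = e^{r̂} and φ̂ be smooth real functions of (T,X) satisfying ∂_T φ̂ + (k+∂_X φ̂)² − γ Â² + γ − k² − ε² Â^{−1}∂_X² Â = Res_φ and ∂_T Â + 2(k+∂_X φ̂)∂_X Â + Â ∂_X² φ̂ = Res_A. Set Ψ̂(T,X) := Â e^{iε^{−1}(ωT + kX + φ̂)} and suppose Ψ̃(t,x) := Ψ̂(εt,εx) V(εt,εx) solves the cubic NLS equation i∂_tΨ̃ + ∂_x²Ψ̃ + γ|Ψ̃|²Ψ̃ = 0, where V is a smooth complex-valued function of (T,X). Then V satisfies, at every (T,X), the equation i∂_T V + ε∂_X² V + 2i(k+∂_X φ̂)∂_X V + 2ε(∂_X r̂)∂_X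 V + γ e^{2r̂} ε^{−1} V(|V|²−1) + (i e^{−r̂} Res_A − ε^{−1} Res_φ) V = 0. -/
open Function

noncomputable section

def pXX (f : ℝ → ℝ → ℝ) (t x : ℝ) : ℝ := deriv (fun y => pX f t y) x
/-- Partial derivatives of complex two-variable functions. -/
def pTc (f : ℝ → ℝ → ℂ) (t x : ℝ) : ℂ := deriv (fun τ => f τ x) t
def pXc (f : ℝ → ℝ → ℂ) (t x : ℝ) : ℂ := deriv (fun y => f t y) x
def pXXc (f : ℝ → ℝ → ℂ) (t x : ℝ) : ℂ := deriv (fun y => pXc f t y) x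

/-- The approximate modulated solution `Ψ̂(T,X) = e^{r̂} e^{iε⁻¹(ωT+kX+φ̂)}` (in slow
variables). -/
def approxPsi (rh φh : ℝ → ℝ → ℝ) (ω k ε : ℝ) : ℝ → ℝ → ℂ :=
  fun T X => ((Real.exp (rh T X) : ℝ) : ℂ) *
    Complex.exp (Complex.I * ((ε⁻¹ * (ω * T + k * X + φh T X) : ℝ) : ℂ))

theorem hasDerivAt_polar_mul {r θ : ℝ → ℝ} {v : ℝ → ℂ} {r' θ' : ℝ} {v' : ℂ} {x : ℝ}
    (hr : HasDerivAt r r' x) (hθ : HasDerivAt θ θ' x) (hv : HasDerivAt v v' x) :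
    HasDerivAt (fun y => ((Real.exp (r y) : ℝ) : ℂ) * Complex.exp (Complex.I * (θ y : ℂ)) * v y)
      (((Real.exp (r x) : ℝ) : ℂ) * Complex.exp (Complex.I * (θ x : ℂ)) *
        (v' + ((r' : ℂ) + Complex.I * (θ' : ℂ)) * v x)) x := by
  have h := (hr.exp.ofReal_comp.mul (hθ.ofReal_comp.const_mul Complex.I).cexp).mul hv
  refine h.congr_deriv ?_
  simp only [Pi.mul_apply]
  push_cast
  ring

theorem deriv_deriv_polar_mul {r θ : ℝ → ℝ} {v : ℝ → ℂ}
    (hr : ContDiff ℝ (⊤ : ℕ∞) r) (hθ : ContDiff ℝ (⊤ : ℕ∞) θ) (hv : ContDiff ℝ (⊤ : ℕ∞) v)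
    (x : ℝ) :
    deriv (deriv fun y =>
        ((Real.exp (r y) : ℝ) : ℂ) * Complex.exp (Complex.I * (θ y : ℂ)) * v y) x =
      ((Real.exp (r x) : ℝ) : ℂ) * Complex.exp (Complex.I * (θ x : ℂ)) *
        (deriv (deriv v) x + 2 * (((deriv r x : ℝ) : ℂ) + Complex.I * ((deriv θ x : ℝ) : ℂ)) * deriv v x
          + (((deriv (deriv r) x : ℝ) : ℂ) + Complex.I * ((deriv (deriv θ) x : ℝ) : ℂ)
            + (((deriv r x : ℝ) : ℂ) + Complex.I * ((deriv θ x : ℝ) : ℂ)) ^ 2) * v x) := by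
  have hr1 := fun y => (hr.differentiable (by simp) y).hasDerivAt
  have hθ1 := fun y => (hθ.differentiable (by simp) y).hasDerivAt
  have hv1 := fun y => (hv.differentiable (by simp) y).hasDerivAt
  have hr2 := ((contDiff_infty_iff_deriv.1 hr).2.differentiable (by simp) x).hasDerivAt
  have hθ2 := ((contDiff_infty_iff_deriv.1 hθ).2.differentiable (by simp) x).hasDerivAt
  have hv2 := ((contDiff_infty_iff_deriv.1 hv).2.differentiable (by simp) x).hasDerivAt
  rw [funext fun y => (hasDerivAt_polar_mul (hr1 y) (hθ1 y) (hv1 y)).deriv]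
  refine ((hasDerivAt_polar_mul (hr1 x) (hθ1 x) (hv2.add ((hr2.ofReal_comp.add
    (hθ2.ofReal_comp.const_mul Complex.I)).mul (hv1 x)))).congr_deriv ?_).deriv
  simp only [Pi.add_apply, Pi.mul_apply]
  ring

theorem deriv_deriv_exp {r : ℝ → ℝ} (hr : ContDiff ℝ (⊤ : ℕ∞) r) (x : ℝ) :
    deriv (deriv fun y => Real.exp (r y)) x =
      Real.exp (r x) * (deriv (deriv r) x + deriv r x ^ 2) := by
  have hr1 := fun y => (hr.differentiable (by simp) y).hasDerivAt
  have hr2 := ((contDiff_infty_iff_deriv.1 hr).2.differentiable (by simp) x).hasDerivAt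
  rw [funext fun y => (hr1 y).exp.deriv]
  exact (((hr1 x).exp.mul hr2).congr_deriv (by ring)).deriv

theorem pTc_comp_mul (F : ℝ → ℝ → ℂ) (ε t x : ℝ) :
    pTc (fun t x => F (ε * t) (ε * x)) t x = (ε : ℂ) * pTc F (ε * t) (ε * x) := by
  simpa [pTc] using deriv_comp_mul_left ε (fun τ => F τ (ε * x)) t

theorem pXXc_comp_mul (F : ℝ → ℝ → ℂ) (ε t x : ℝ) :
    pXXc (fun t x => F (ε * t) (ε * x)) t x = (ε : ℂ) ^ 2 * pXXc F (ε * t) (ε * x) := by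
  have h : ∀ y, pXc (fun t x => F (ε * t) (ε * x)) t y = (ε : ℂ) * pXc F (ε * t) (ε * y) :=
    fun y => by simpa [pXc] using deriv_comp_mul_left ε (fun z => F (ε * t) z) y
  have h2 := deriv_comp_mul_left ε (fun z => pXc F (ε * t) z) x
  simp only [pXXc, h, deriv_const_mul_field, h2, Complex.real_smul]
  ring

theorem norm_approxPsi (rh φh : ℝ → ℝ → ℝ) (ω k ε T X : ℝ) :
    ‖approxPsi rh φh ω k ε T X‖ = Real.exp (rh T X) := by
  rw [approxPsi, norm_mul, mul_comm Complex.I, Complex.norm_exp_ofReal_mul_I, Complex.norm_real,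
    Real.norm_of_nonneg (Real.exp_pos _).le, mul_one]

theorem approxPsi_ne_zero (rh φh : ℝ → ℝ → ℝ) (ω k ε T X : ℝ) :
    approxPsi rh φh ω k ε T X ≠ 0 := by
  rw [← norm_ne_zero_iff, norm_approxPsi]
  exact (Real.exp_pos _).ne'

theorem pTc_approxPsi_mul {rh φh : ℝ → ℝ → ℝ} {V : ℝ → ℝ → ℂ} {T X : ℝ} (ω k ε : ℝ)
    (hr : DifferentiableAt ℝ (fun τ => rh τ X) T) (hφ : DifferentiableAt ℝ (fun τ => φh τ X) T)
    (hV : DifferentiableAt ℝ (fun τ => V τ X) T) :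
    pTc (fun T X => approxPsi rh φh ω k ε T X * V T X) T X =
      approxPsi rh φh ω k ε T X * (pTc V T X
        + ((pT rh T X : ℂ) + Complex.I * ((ε⁻¹ * (ω + pT φh T X) : ℝ) : ℂ)) * V T X) := by
  have hθ : HasDerivAt (fun τ => ε⁻¹ * (ω * τ + k * X + φh τ X)) (ε⁻¹ * (ω + pT φh T X)) T := by
    simpa [pT] using
      ((((hasDerivAt_id T).const_mul ω).add_const (k * X)).add hφ.hasDerivAt).const_mul ε⁻¹
  exact (hasDerivAt_polar_mul hr.hasDerivAt hθ hV.hasDerivAt).deriv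

theorem pXXc_approxPsi_mul {rh φh : ℝ → ℝ → ℝ} {V : ℝ → ℝ → ℂ} {T : ℝ} (ω k ε : ℝ)
    (hr : ContDiff ℝ (⊤ : ℕ∞) (rh T)) (hφ : ContDiff ℝ (⊤ : ℕ∞) (φh T))
    (hV : ContDiff ℝ (⊤ : ℕ∞) (V T)) (X : ℝ) :
    pXXc (fun T X => approxPsi rh φh ω k ε T X * V T X) T X =
      approxPsi rh φh ω k ε T X * (pXXc V T X
        + 2 * ((pX rh T X : ℂ) + Complex.I * ((ε⁻¹ * (k + pX φh T X) : ℝ) : ℂ)) * pXc V T X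
        + ((pXX rh T X : ℂ) + Complex.I * ((ε⁻¹ * pXX φh T X : ℝ) : ℂ)
          + ((pX rh T X : ℂ) + Complex.I * ((ε⁻¹ * (k + pX φh T X) : ℝ) : ℂ)) ^ 2) * V T X) := by
  have hθ : ContDiff ℝ (⊤ : ℕ∞) (fun y => ε⁻¹ * (ω * T + k * y + φh T y)) := by fun_prop
  have hθ1 : deriv (fun y => ε⁻¹ * (ω * T + k * y + φh T y)) =
      fun y => ε⁻¹ * (k + pX φh T y) := funext fun y => by
    have hφ1 := (hφ.differentiable (by simp) y).hasDerivAt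
    exact (((((hasDerivAt_id y).const_mul k).const_add (ω * T)).add hφ1).const_mul ε⁻¹
      |>.congr_deriv (by simp [pX])).deriv
  have hθ2 : deriv (fun y => ε⁻¹ * (k + pX φh T y)) X = ε⁻¹ * pXX φh T X := by
    simp [pXX]
  have h := deriv_deriv_polar_mul hr hθ hV X
  rw [hθ1, hθ2] at h
  exact h

/-- if `(Â,φ̂) = (e^{r̂},φ̂)` satisfies the amplitude–phase system with
residuals `Res_A, Res_φ` and `Ψ̃(t,x) = Ψ̂(εt,εx)V(εt,εx)` solves cubic NLS, then the
relative deviation `V` satisfies the singularly perturbed equation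
`i∂_TV + ε∂_X²V + 2i(k+∂_Xφ̂)∂_XV + 2ε(∂_Xr̂)∂_XV + γe^{2r̂}ε⁻¹V(|V|²−1)
 + (ie^{−r̂}Res_A − ε⁻¹Res_φ)V = 0`. -/
theorem deviation_equation_derivation
    (γ ω k ε : ℝ) (hε : 0 < ε) (hγ : γ = ω + k ^ 2)
    (rh φh ResA Resφ : ℝ → ℝ → ℝ) (V : ℝ → ℝ → ℂ)
    (hrh : ContDiff ℝ (⊤ : ℕ∞) (uncurry rh)) (hφh : ContDiff ℝ (⊤ : ℕ∞) (uncurry φh))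
    (hV : ContDiff ℝ (⊤ : ℕ∞) (uncurry V))
    (hphase : ∀ T X : ℝ,
      pT φh T X + (k + pX φh T X) ^ 2 - γ * (Real.exp (rh T X)) ^ 2 + γ - k ^ 2
          - ε ^ 2 * (Real.exp (rh T X))⁻¹ * pXX (fun T X => Real.exp (rh T X)) T X
        = Resφ T X)
    (hamp : ∀ T X : ℝ,
      pT (fun T X => Real.exp (rh T X)) T X
          + 2 * (k + pX φh T X) * pX (fun T X => Real.exp (rh T X)) T X
          + Real.exp (rh T X) * pXX φh T X
        = ResA T X)
    (hNLS : ∀ t x : ℝ,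
      Complex.I * pTc (fun t x => approxPsi rh φh ω k ε (ε * t) (ε * x) * V (ε * t) (ε * x)) t x
        + pXXc (fun t x => approxPsi rh φh ω k ε (ε * t) (ε * x) * V (ε * t) (ε * x)) t x
        + (γ : ℂ) *
            ((‖approxPsi rh φh ω k ε (ε * t) (ε * x) * V (ε * t) (ε * x)‖ ^ 2 : ℝ) : ℂ) *
            (approxPsi rh φh ω k ε (ε * t) (ε * x) * V (ε * t) (ε * x)) = 0) :
    ∀ T X : ℝ,
      Complex.I * pTc V T X + (ε : ℂ) * pXXc V T X
        + 2 * Complex.I * ((k + pX φh T X : ℝ) : ℂ) * pXc V T X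
        + 2 * (ε : ℂ) * ((pX rh T X : ℝ) : ℂ) * pXc V T X
        + (γ : ℂ) * ((Real.exp (2 * rh T X) : ℝ) : ℂ) * (ε : ℂ)⁻¹ *
            V T X * (((‖V T X‖ ^ 2 : ℝ) : ℂ) - 1)
        + (Complex.I * ((Real.exp (-(rh T X)) : ℝ) : ℂ) * ((ResA T X : ℝ) : ℂ)
            - (ε : ℂ)⁻¹ * ((Resφ T X : ℝ) : ℂ)) * V T X = 0 := by
  intro T X
  have slice1 : ContDiff ℝ (⊤ : ℕ∞) fun τ : ℝ => (τ, X) := by fun_prop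
  have slice2 : ContDiff ℝ (⊤ : ℕ∞) fun y : ℝ => (T, y) := by fun_prop
  have hr1 : DifferentiableAt ℝ (fun τ => rh τ X) T :=
    (hrh.comp slice1).differentiable (by simp) T
  have hφ1 : DifferentiableAt ℝ (fun τ => φh τ X) T :=
    (hφh.comp slice1).differentiable (by simp) T
  have hV1 : DifferentiableAt ℝ (fun τ => V τ X) T :=
    (hV.comp slice1).differentiable (by simp) T
  have hr2 : ContDiff ℝ (⊤ : ℕ∞) (rh T) := hrh.comp slice2
  have hφ2 : ContDiff ℝ (⊤ : ℕ∞) (φh T) := hφh.comp slice2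
  have hV2 : ContDiff ℝ (⊤ : ℕ∞) (V T) := hV.comp slice2
  have hε0 : ε ≠ 0 := hε.ne'
  have hεc : (ε : ℂ) ≠ 0 := Complex.ofReal_ne_zero.2 hε0
  have hexpT : pT (fun T X => Real.exp (rh T X)) T X = Real.exp (rh T X) * pT rh T X :=
    hr1.hasDerivAt.exp.deriv
  have hexpX : pX (fun T X => Real.exp (rh T X)) T X = Real.exp (rh T X) * pX rh T X :=
    (hr2.differentiable (by simp) X).hasDerivAt.exp.deriv
  have hexpXX : pXX (fun T X => Real.exp (rh T X)) T X =
      Real.exp (rh T X) * (pXX rh T X + pX rh T X ^ 2) := deriv_deriv_exp hr2 X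
  have hE := (Real.exp_pos (rh T X)).ne'
  have hA : Real.exp (-(rh T X)) * ResA T X =
      pT rh T X + 2 * (k + pX φh T X) * pX rh T X + pXX φh T X := by
    rw [← hamp T X, hexpT, hexpX, Real.exp_neg]
    field_simp
  have hP : Resφ T X = pT φh T X + (k + pX φh T X) ^ 2 - γ * Real.exp (2 * rh T X) + ω
      - ε ^ 2 * (pXX rh T X + pX rh T X ^ 2) := by
    rw [← hphase T X, hexpXX, hγ, two_mul, Real.exp_add]
    field_simp
    ring
  have hN := hNLS (ε⁻¹ * T) (ε⁻¹ * X)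
  rw [pTc_comp_mul (fun T X => approxPsi rh φh ω k ε T X * V T X),
    pXXc_comp_mul (fun T X => approxPsi rh φh ω k ε T X * V T X), mul_inv_cancel_left₀ hε0,
    mul_inv_cancel_left₀ hε0, pTc_approxPsi_mul ω k ε hr1 hφ1 hV1,
    pXXc_approxPsi_mul ω k ε hr2 hφ2 hV2, norm_mul, norm_approxPsi, mul_pow,
    ← Real.exp_nat_mul] at hN
  rw [mul_assoc Complex.I, ← Complex.ofReal_mul (Real.exp (-(rh T X))), hA, hP]
  refine (mul_eq_zero.1 ?_).resolve_left
    (mul_ne_zero hεc (approxPsi_ne_zero rh φh ω k ε T X))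
  rw [← hN]
  push_cast
  field_simp
  ring_nf
  simp only [Complex.I_sq]
  ring
end
end
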